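/- arXiv:hep-th/9408111 — 5 statements merged into one kernel-verified Lean document; each statement's English description precedes it below -/
import Mathlib

section
/- Let q > 1 be a real number and let E, m2 ∈ ℝ with m2 ≤ 0, and assume moreover that m2 < 0 or E ≠ 0. Then γ(l) > 0 for every l ∈ ℕ. (This is case (i) of the positivity analysis: for non-positive mass squared there is no restriction on the energy E, since all squared norms stay positive.) -/
/-- The q-number [x]_q = (q^x - q^(-x))/(q - q⁻¹). -/
noncomputable def qnum (q x : ℝ) : ℝ := (q ^ x - q ^ (-x)) / (q - q⁻¹)

/-- The symmetric q-number ⟨x⟩_q = (q^x + q^(-x))/(q + q⁻¹). -/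
noncomputable def sqnum (q x : ℝ) : ℝ := (q ^ x + q ^ (-x)) / (q + q⁻¹)

/-- The squared-norm recursion γ(0) = 1,
    γ(l+1) = (q²·[l+1]_q/[2l+3]_q)·(E²/⟨l+1⟩_q − ⟨l+1⟩_q·m2)·γ(l). -/
noncomputable def gam (q E m2 : ℝ) : ℕ → ℝ
  | 0 => 1
  | l + 1 =>
      (q ^ 2 * qnum q ((l : ℝ) + 1) / qnum q (2 * (l : ℝ) + 3)) *
        (E ^ 2 / sqnum q ((l : ℝ) + 1) - sqnum q ((l : ℝ) + 1) * m2) * gam q E m2 l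

theorem qnum_pos {q x : ℝ} (hq : 1 < q) (hx : 0 < x) : 0 < qnum q x := by
  have hinv : q⁻¹ < 1 := inv_lt_one_of_one_lt₀ hq
  have hpow : q ^ (-x) < q ^ x := Real.rpow_lt_rpow_of_exponent_lt hq (by linarith)
  exact div_pos (by linarith) (by linarith)

theorem sqnum_pos {q : ℝ} (hq : 0 < q) (x : ℝ) : 0 < sqnum q x := by
  unfold sqnum
  positivity

theorem stmt_0 (q E m2 : ℝ) (hq : 1 < q) (hm : m2 ≤ 0)
    (h : m2 < 0 ∨ E ≠ 0) : ∀ l : ℕ, 0 < gam q E m2 l := by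
  intro l
  induction l with
  | zero => simp [gam]
  | succ l ih =>
    have hq0 : 0 < q := by linarith
    have hn := qnum_pos hq (x := (l : ℝ) + 1) (by positivity)
    have hd := qnum_pos hq (x := 2 * (l : ℝ) + 3) (by positivity)
    have hs := sqnum_pos hq0 ((l : ℝ) + 1)
    rw [gam]
    refine mul_pos (mul_pos (by positivity) ?_) ih
    rcases h with h | h
    · have hE : 0 ≤ E ^ 2 / sqnum q ((l : ℝ) + 1) := by positivity
      linarith [mul_neg_of_pos_of_neg hs h]
    · have hE : 0 < E ^ 2 / sqnum q ((l : ℝ) + 1) := by positivity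
      linarith [mul_nonpos_of_nonneg_of_nonpos hs.le hm]
end

section
/- Let q > 1 be a real number, let m2 > 0 and E ∈ ℝ, and suppose that E² ≠ ⟨N+1⟩_q²·m2 for every N ∈ ℕ. Then there exists l ∈ ℕ with γ(l) < 0. (This is the essential content of case (ii): for positive mass squared and generic energy the squared norms eventually become negative, so positivity fails.) -/
theorem exists_lt_sqnum {q : ℝ} (hq : 1 < q) (c : ℝ) : ∃ l : ℕ, c < sqnum q ((l : ℝ) + 1) := by
  have hq0 : 0 < q := by linarith
  obtain ⟨n, hn⟩ := pow_unbounded_of_one_lt (c * (q + q⁻¹)) hq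
  refine ⟨n, ?_⟩
  rw [sqnum, lt_div_iff₀ (by positivity)]
  have hmono : q ^ (n : ℝ) < q ^ ((n : ℝ) + 1) :=
    Real.rpow_lt_rpow_of_exponent_lt hq (by linarith)
  have hneg : 0 < q ^ (-((n : ℝ) + 1)) := Real.rpow_pos_of_pos hq0 _
  rw [Real.rpow_natCast] at hmono
  linarith

theorem gam_succ_coeff_pos {q : ℝ} (hq : 1 < q) (l : ℕ) :
    0 < q ^ 2 * qnum q ((l : ℝ) + 1) / qnum q (2 * (l : ℝ) + 3) := by
  have h₁ : 0 < qnum q ((l : ℝ) + 1) := qnum_pos hq (by positivity)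
  have h₂ : 0 < qnum q (2 * (l : ℝ) + 3) := qnum_pos hq (by positivity)
  positivity

theorem div_sqnum_sub {q : ℝ} (hq : 0 < q) (E m2 x : ℝ) :
    E ^ 2 / sqnum q x - sqnum q x * m2 = (E ^ 2 - sqnum q x ^ 2 * m2) / sqnum q x := by
  have := (sqnum_pos hq x).ne'
  field_simp

theorem gam_ne_zero {q E m2 : ℝ} (hq : 1 < q)
    (h : ∀ N : ℕ, E ^ 2 ≠ (sqnum q ((N : ℝ) + 1)) ^ 2 * m2) (l : ℕ) : gam q E m2 l ≠ 0 := by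
  have hq0 : 0 < q := by linarith
  induction l with
  | zero => simp [gam]
  | succ l ih =>
    rw [gam, div_sqnum_sub hq0]
    exact mul_ne_zero (mul_ne_zero (gam_succ_coeff_pos hq l).ne'
      (div_ne_zero (sub_ne_zero.2 (h l)) (sqnum_pos hq0 _).ne')) ih

theorem stmt_1 (q E m2 : ℝ) (hq : 1 < q) (hm : 0 < m2)
    (h : ∀ N : ℕ, E ^ 2 ≠ (sqnum q ((N : ℝ) + 1)) ^ 2 * m2) :
    ∃ l : ℕ, gam q E m2 l < 0 := by
  by_contra! hnonneg
  have hq0 : 0 < q := by linarith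
  have hpos (l : ℕ) : 0 < gam q E m2 l := (hnonneg l).lt_of_ne' (gam_ne_zero hq h l)
  obtain ⟨l, hl⟩ := exists_lt_sqnum hq √(E ^ 2 / m2)
  have hlarge : E ^ 2 < sqnum q ((l : ℝ) + 1) ^ 2 * m2 :=
    (div_lt_iff₀ hm).1 ((Real.sqrt_lt' (sqnum_pos hq0 _)).1 hl)
  have hsucc := hpos (l + 1)
  rw [gam, div_sqnum_sub hq0] at hsucc
  have hfactor := pos_of_mul_pos_right (pos_of_mul_pos_left hsucc (hpos l).le)
    (gam_succ_coeff_pos hq l).le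
  exact hfactor.not_gt (div_neg_of_neg_of_pos (by linarith) (sqnum_pos hq0 _))
end

section
/- Let q > 1 be a real number, let m2 > 0, let N ∈ ℕ, and suppose E² = ⟨N+1⟩_q²·m2. Then γ(l) > 0 for all l ≤ N and γ(l) = 0 for all l > N. (Thus for the quantized energy eigenvalue labelled by N, the recursion terminates exactly after step N and all surviving highest-weight vectors have strictly positive squared norm, so the states |M,N,l,m⟩ with l ≤ N span a positive-definite space.) -/
theorem sqnum_lt_sqnum {q x y : ℝ} (hq : 1 < q) (hx : 0 ≤ x) (hxy : x < y) :
    sqnum q x < sqnum q y := by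
  have hq0 : 0 < q := by linarith
  have ha : 1 ≤ q ^ x := Real.one_le_rpow hq.le hx
  have hab : q ^ x < q ^ y := Real.rpow_lt_rpow_of_exponent_lt hq hxy
  unfold sqnum
  rw [Real.rpow_neg hq0.le, Real.rpow_neg hq0.le]
  refine div_lt_div_of_pos_right ?_ (by positivity)
  generalize q ^ x = a at *
  generalize q ^ y = b at *
  have ha0 : 0 < a := by linarith
  have hb0 : 0 < b := by linarith
  have hprod : 1 < a * b := by nlinarith
  have hdiff : b + b⁻¹ - (a + a⁻¹) = (b - a) * (a * b - 1) / (a * b) := by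
    field_simp
    ring
  have : 0 < (b - a) * (a * b - 1) / (a * b) :=
    div_pos (mul_pos (by linarith) (by linarith)) (by positivity)
  linarith

theorem stmt_3 (q E m2 : ℝ) (hq : 1 < q) (hm : 0 < m2) (N : ℕ)
    (hE : E ^ 2 = (sqnum q ((N : ℝ) + 1)) ^ 2 * m2) :
    (∀ l : ℕ, l ≤ N → 0 < gam q E m2 l) ∧ (∀ l : ℕ, N < l → gam q E m2 l = 0) := by
  have hq0 : 0 < q := by linarith
  constructor
  · intro l
    induction l with
    | zero => intro _; simp [gam]
    | succ l ih =>
      intro hl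
      have hlN : (l : ℝ) + 1 < (N : ℝ) + 1 := by
        have : (l : ℝ) < N := by exact_mod_cast hl
        linarith
      have hs := sqnum_pos hq0 ((l : ℝ) + 1)
      have hlt := sqnum_lt_sqnum hq (by positivity) hlN
      have h₁ : 0 < qnum q ((l : ℝ) + 1) := qnum_pos hq (by positivity)
      have h₂ : 0 < qnum q (2 * (l : ℝ) + 3) := qnum_pos hq (by positivity)
      have h₃ : 0 < E ^ 2 / sqnum q ((l : ℝ) + 1) - sqnum q ((l : ℝ) + 1) * m2 := by
        rw [sub_pos, lt_div_iff₀ hs, hE]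
        have := mul_lt_mul_of_pos_right (pow_lt_pow_left₀ hlt hs.le two_ne_zero) hm
        linarith
      have h₄ := ih (by omega)
      rw [gam]
      positivity
  · intro l hl
    induction l, hl using Nat.le_induction with
    | base =>
      have hs := (sqnum_pos hq0 ((N : ℝ) + 1)).ne'
      have : E ^ 2 / sqnum q ((N : ℝ) + 1) - sqnum q ((N : ℝ) + 1) * m2 = 0 := by
        rw [hE]
        field_simp
        ring
      rw [gam, this, mul_zero, zero_mul]
    | succ l _ ih => rw [gam, ih, mul_zero]
end

section
/- Let q > 1 be a real number and let m2, E ∈ ℝ. Then the recursion coefficient c(l) := (q²·[l+1]_q/[2l+3]_q)·(E²/⟨l+1⟩_q − ⟨l+1⟩_q·m2) converges as l → ∞ to −m2·q²/(q² + 1). (Asymptotics of the coefficient in the norm recursion; in particular for m2 > 0 the limiting coefficient is strictly negative.) -/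
theorem stmt_9 (q E m2 : ℝ) (hq : 1 < q) :
    Filter.Tendsto
      (fun l : ℕ =>
        (q ^ 2 * qnum q ((l : ℝ) + 1) / qnum q (2 * (l : ℝ) + 3)) *
          (E ^ 2 / sqnum q ((l : ℝ) + 1) - sqnum q ((l : ℝ) + 1) * m2))
      Filter.atTop (nhds (-m2 * q ^ 2 / (q ^ 2 + 1))) := by
  have hq0 : 0 < q := by linarith
  let F : ℝ → ℝ := fun u => q ^ 2 * (1 - u ^ 2) / (q - u ^ 4 / q) *
    (E ^ 2 * (q + q⁻¹) * u ^ 2 / (1 + u ^ 2) - (1 + u ^ 2) * m2 / (q + q⁻¹))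
  have hF : ContinuousAt F 0 := by
    have h1 : q - (0 : ℝ) ^ 4 / q ≠ 0 := by simpa using hq0.ne'
    have h2 : (1 : ℝ) + 0 ^ 2 ≠ 0 := by norm_num
    have h3 : q + q⁻¹ ≠ 0 := by positivity
    fun_prop (disch := assumption)
  have hF0 : F 0 = -m2 * q ^ 2 / (q ^ 2 + 1) := by
    simp only [F]
    field_simp
    ring
  have hu : Filter.Tendsto (fun l : ℕ => q⁻¹ ^ (l + 1)) Filter.atTop (nhds 0) :=
    (tendsto_pow_atTop_nhds_zero_of_lt_one (inv_nonneg.2 hq0.le) (inv_lt_one_of_one_lt₀ hq)).comp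
      (Filter.tendsto_add_atTop_nat 1)
  have hlim := hF.tendsto.comp hu
  rw [hF0] at hlim
  refine hlim.congr fun l => ?_
  have hn : q ^ ((l : ℝ) + 1) = q ^ (l + 1) := by exact_mod_cast Real.rpow_natCast q (l + 1)
  have hm : q ^ (2 * (l : ℝ) + 3) = q * (q ^ (l + 1)) ^ 2 := by
    rw [← pow_mul, ← pow_succ', ← Real.rpow_natCast]
    push_cast
    ring_nf
  simp only [Function.comp_apply, F, qnum, sqnum, Real.rpow_neg hq0.le, hn, hm, inv_pow]
  have hv : 1 < q ^ (l + 1) := one_lt_pow₀ hq (by omega)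
  generalize q ^ (l + 1) = v at hv
  have hv0 : 0 < v := by linarith
  have h1 : q ^ 2 - 1 ≠ 0 := by nlinarith
  have hv4 : 1 < v ^ 4 := one_lt_pow₀ hv (by norm_num)
  have h2 : q ^ 2 * v ^ 4 - 1 ≠ 0 := by nlinarith
  have e1 : q - q⁻¹ = (q ^ 2 - 1) / q := by field_simp
  have e2 : q - (v ^ 4)⁻¹ / q = (q ^ 2 * v ^ 4 - 1) / (q * v ^ 4) := by field_simp
  have e3 : q * v ^ 2 - (q * v ^ 2)⁻¹ = (q ^ 2 * v ^ 4 - 1) / (q * v ^ 2) := by field_simp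
  rw [e1, e2, e3]
  field_simp
end

section
/- Let q > 1 be a real number, m2 > 0, N ∈ ℕ, and suppose E² = ⟨N+1⟩_q²·m2. Then for every l ∈ ℕ the squared norm has the closed form γ(l) = ∏_{j=1}^{l} (q²·[j]_q/([2j+1]_q·⟨j⟩_q))·m2·((q − q^{−1})/(q + q^{−1}))²·[N+1+j]_q·[N+1−j]_q. (Each factor is strictly positive for j ≤ N and the factor with j = N+1 vanishes, making the termination of the recursion at level N manifest.) -/
theorem sqnum_sq_sub_sq {q : ℝ} (hq : 1 < q) (a b : ℝ) :
    sqnum q a ^ 2 - sqnum q b ^ 2 =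
      ((q - q⁻¹) / (q + q⁻¹)) ^ 2 * qnum q (a + b) * qnum q (a - b) := by
  have h0 : 0 < q := by linarith
  have hd : q - q⁻¹ ≠ 0 := by
    have := inv_lt_one_of_one_lt₀ hq
    linarith
  have hs : q + q⁻¹ ≠ 0 := by positivity
  have ha : q ^ a * q ^ (-a) = 1 := by rw [← Real.rpow_add h0, add_neg_cancel, Real.rpow_zero]
  have hb : q ^ b * q ^ (-b) = 1 := by rw [← Real.rpow_add h0, add_neg_cancel, Real.rpow_zero]
  unfold sqnum qnum
  rw [show -(a + b) = -a + -b by ring, show -(a - b) = -a + b by ring, sub_eq_add_neg a b]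
  simp only [Real.rpow_add h0]
  generalize q ^ a = A at *
  generalize q ^ (-a) = A' at *
  generalize q ^ b = B at *
  generalize q ^ (-b) = B' at *
  generalize q - q⁻¹ = d at *
  generalize q + q⁻¹ = s at *
  field_simp
  linear_combination (2 + B ^ 2 + B' ^ 2) * ha - (2 + A ^ 2 + A' ^ 2) * hb

theorem stmt_10 (q E m2 : ℝ) (hq : 1 < q) (hm : 0 < m2) (N : ℕ)
    (hE : E ^ 2 = (sqnum q ((N : ℝ) + 1)) ^ 2 * m2) :
    ∀ l : ℕ, gam q E m2 l =
      ∏ j ∈ Finset.Icc 1 l,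
        (q ^ 2 * qnum q (j : ℝ) / (qnum q (2 * (j : ℝ) + 1) * sqnum q (j : ℝ))) *
          m2 * ((q - q⁻¹) / (q + q⁻¹)) ^ 2 *
          qnum q ((N : ℝ) + 1 + (j : ℝ)) * qnum q ((N : ℝ) + 1 - (j : ℝ)) := by
  intro l
  induction l with
  | zero => simp [gam]
  | succ l ih =>
    rw [Finset.prod_Icc_succ_top (by omega), ← ih, gam, hE, mul_comm]
    congr 1
    push_cast
    have hs := (sqnum_pos (by linarith : 0 < q) ((l : ℝ) + 1)).ne'
    have key := sqnum_sq_sub_sq hq ((N : ℝ) + 1) ((l : ℝ) + 1)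
    rw [show 2 * ((l : ℝ) + 1) + 1 = 2 * l + 3 by ring]
    have hfac : sqnum q ((N : ℝ) + 1) ^ 2 * m2 / sqnum q ((l : ℝ) + 1)
          - sqnum q ((l : ℝ) + 1) * m2 =
        (sqnum q ((N : ℝ) + 1) ^ 2 - sqnum q ((l : ℝ) + 1) ^ 2) * m2
          / sqnum q ((l : ℝ) + 1) := by
      field_simp
    rw [hfac, key, ← div_div]
    ring
end
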